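/- Let SSE be the Slot Set Encoder with fixed slots S ∈ ℝ^{K×h} and fixed linear maps q, k, v. For every input X ∈ ℝ^{n×d} and every permutation matrix π_X ∈ ℝ^{n×n}, it holds that SSE(π_X · X, S) = SSE(X, S); i.e., the Slot Set Encoder is invariant under permutations of the input set elements. -/

import Mathlib

open Matrix

/-- The sigmoid function `σ(z) = 1/(1+e^{-z})`. -/
noncomputable def sigmoid (z : ℝ) : ℝ := 1 / (1 + Real.exp (-z))

/-- The Slot Set Encoder (see the paper): `M(X,S) = (1/√d̂)·k(X)·q(S)ᵀ`,
`attn(X,S) = σ(M(X,S))` entrywise, `W(X,S)_{i,j} = attn(X,S)_{i,j}/∑_l attn(X,S)_{i,l}`,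
`SSE(X,S) = W(X,S)ᵀ·v(X)`, where the row-wise linear maps `k, v, q` are given by right
multiplication with `Km, Vm, Qm`. -/
noncomputable def SSE {n d dh h K : ℕ}
    (Km : Matrix (Fin d) (Fin dh) ℝ) (Qm : Matrix (Fin h) (Fin dh) ℝ)
    (Vm : Matrix (Fin d) (Fin dh) ℝ)
    (X : Matrix (Fin n) (Fin d) ℝ) (S : Matrix (Fin K) (Fin h) ℝ) :
    Matrix (Fin K) (Fin dh) ℝ :=
  let M : Matrix (Fin n) (Fin K) ℝ := (1 / Real.sqrt dh) • (X * Km * (S * Qm)ᵀ)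
  let attn : Matrix (Fin n) (Fin K) ℝ := Matrix.of fun i j => sigmoid (M i j)
  let W : Matrix (Fin n) (Fin K) ℝ := Matrix.of fun i j => attn i j / ∑ l, attn i l
  Wᵀ * (X * Vm)

/-- A permutation matrix: a square 0–1 matrix with exactly one 1 in each row and each column. -/
def IsPermMatrix {m : ℕ} (P : Matrix (Fin m) (Fin m) ℝ) : Prop :=
  (∀ i j, P i j = 0 ∨ P i j = 1) ∧ (∀ i, ∃! j, P i j = 1) ∧ (∀ j, ∃! i, P i j = 1)

/-- Left multiplication by a permutation matrix permutes the rows. -/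
lemma IsPermMatrix.exists_perm_mul_eq_submatrix {m : ℕ} {P : Matrix (Fin m) (Fin m) ℝ}
    (hP : IsPermMatrix P) :
    ∃ e : Equiv.Perm (Fin m), ∀ {p : ℕ} (A : Matrix (Fin m) (Fin p) ℝ),
      P * A = A.submatrix e id := by
  obtain ⟨h01, hrow, hcol⟩ := hP
  choose f hf hf_unique using hrow
  have hinj : Function.Injective f := fun i j hij =>
    (hcol (f i)).unique (hf i) (hij ▸ hf j)
  refine ⟨Equiv.ofBijective f (Finite.injective_iff_bijective.mp hinj), fun A => ?_⟩
  ext i j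
  rw [Matrix.mul_apply, Finset.sum_eq_single (f i)]
  · simp [hf i]
  · intro k _ hk
    rw [(h01 i k).resolve_right fun h => hk (hf_unique i k h), zero_mul]
  · simp

/-- Reindexing the rows of the input does not change the Slot Set Encoder. -/
lemma SSE_submatrix {n d dh h K : ℕ}
    (Km : Matrix (Fin d) (Fin dh) ℝ) (Qm : Matrix (Fin h) (Fin dh) ℝ)
    (Vm : Matrix (Fin d) (Fin dh) ℝ)
    (X : Matrix (Fin n) (Fin d) ℝ) (S : Matrix (Fin K) (Fin h) ℝ)
    (e : Equiv.Perm (Fin n)) :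
    SSE Km Qm Vm (X.submatrix e id) S = SSE Km Qm Vm X S := by
  ext a b
  simp only [SSE, Matrix.mul_apply, Matrix.transpose_apply, Matrix.of_apply, Matrix.smul_apply,
    Matrix.submatrix_apply, id_eq]
  exact Equiv.sum_comp e fun i =>
    (sigmoid ((1 / √(dh : ℝ)) • ∑ c, (∑ r, X i r * Km r c) * ∑ r, S a r * Qm r c) /
      ∑ l, sigmoid ((1 / √(dh : ℝ)) • ∑ c, (∑ r, X i r * Km r c) * ∑ r, S l r * Qm r c)) *
      ∑ r, X i r * Vm r b

/-- **Permutation invariance of the Slot Set Encoder w.r.t. the input set elements.**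
For fixed slots `S` and every permutation matrix `π_X ∈ ℝ^{n×n}`,
`SSE(π_X·X, S) = SSE(X, S)`. -/
theorem sse_perm_invariant {n d dh h K : ℕ}
    (Km : Matrix (Fin d) (Fin dh) ℝ) (Qm : Matrix (Fin h) (Fin dh) ℝ)
    (Vm : Matrix (Fin d) (Fin dh) ℝ)
    (X : Matrix (Fin n) (Fin d) ℝ) (S : Matrix (Fin K) (Fin h) ℝ)
    (πX : Matrix (Fin n) (Fin n) ℝ) (hπX : IsPermMatrix πX) :
    SSE Km Qm Vm (πX * X) S = SSE Km Qm Vm X S := by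
  obtain ⟨e, he⟩ := hπX.exists_perm_mul_eq_submatrix
  rw [he, SSE_submatrix]
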